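/- arXiv:1908.10242 — 6 statements merged into one kernel-verified Lean document; each statement's English description precedes it below -/
import Mathlib

section
/- Let Q be a probability measure on ℝ^T with marginals Q_t = μ_t for t = 1,…,T, and for (s,t,τ) ∈ Δ and k ∈ ℝ define the pricing rule p_{s,τ,k}(x) := ∫ (y−k)^+ K_{s,s+τ}(x,dy). Then Q is homogeneous if and only if for every (s,t,τ) ∈ Δ and every k ∈ ℝ the equality p_{s,τ,k} = p_{t,τ,k} holds μ_s ∧ μ_t-almost surely. -/
open MeasureTheory ProbabilityTheory

noncomputable section

/-- The `t`-th one-dimensional marginal of a measure on `ℝ^T`. -/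
def marginal {T : ℕ} (Q : Measure (Fin T → ℝ)) (t : Fin T) : Measure ℝ :=
  Q.map (fun x => x t)

/-- The joint law of the coordinates `(s, u)`. -/
def joint {T : ℕ} (Q : Measure (Fin T → ℝ)) (s u : Fin T) : Measure (ℝ × ℝ) :=
  Q.map (fun x => (x s, x u))

/-- `K` is a disintegration kernel of `Q` over the coordinates `(s, u)`:
`Q_{(s,u)} = Q_s ⊗ K`. -/
def IsDisint {T : ℕ} (Q : Measure (Fin T → ℝ)) (s u : Fin T) (K : Kernel ℝ ℝ) : Prop :=
  IsMarkovKernel K ∧ joint Q s u = (marginal Q s).compProd K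

/-- The absolutely continuous part `μ^{ν,abs}` of `μ` with respect to `ν` in the
Lebesgue decomposition. -/
def absPart (μ ν : Measure ℝ) : Measure ℝ := ν.withDensity (μ.rnDeriv ν)

/-- `Q` is homogeneous: for every `(s,t,τ) ∈ Δ`, the disintegration kernels satisfy
`K_{s,s+τ} = K_{t,t+τ}` a.s. with respect to `Q_s ∧ Q_t`, i.e. w.r.t. the absolutely
continuous part of `Q_s` with respect to `Q_t`. -/
def IsHom {T : ℕ} (Q : Measure (Fin T → ℝ)) : Prop :=
  ∀ (s t : Fin T) (τ : ℕ) (hs : s.val + τ < T) (ht : t.val + τ < T),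
    s < t → 1 ≤ τ →
    ∀ Ks Kt : Kernel ℝ ℝ,
      IsDisint Q s ⟨s.val + τ, hs⟩ Ks → IsDisint Q t ⟨t.val + τ, ht⟩ Kt →
      ∀ᵐ x ∂(absPart (marginal Q s) (marginal Q t)), Ks x = Kt x

/-- Two probability measures on `ℝ` with finite first moments and equal call prices at rational
strikes coincide. -/
theorem measure_eq_of_calls (m n : Measure ℝ) [IsProbabilityMeasure m] [IsProbabilityMeasure n]
    (hm : Integrable (fun y : ℝ => y) m) (hn : Integrable (fun y : ℝ => y) n)
    (h : ∀ q : ℚ, ∫ y, max (y - (q : ℝ)) 0 ∂m = ∫ y, max (y - (q : ℝ)) 0 ∂n) : m = n := by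
  have key : ∀ (r : Measure ℝ) [IsProbabilityMeasure r], Integrable (fun y : ℝ => y) r →
      ∀ a : ℚ, Filter.Tendsto (fun j : ℕ => ((j : ℝ) + 1) *
        (∫ y, max (y - (a : ℝ)) 0 ∂r - ∫ y, max (y - ((a + 1 / ((j : ℚ) + 1) : ℚ) : ℝ)) 0 ∂r))
        Filter.atTop (nhds (r.real (Set.Ioi (a : ℝ)))) := by
    intro r _ hr a
    have hi : ∀ k : ℝ, Integrable (fun y : ℝ => max (y - k) 0) r := fun k =>
      (hr.sub (integrable_const k)).pos_part
    rw [← integral_indicator_one measurableSet_Ioi]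
    have e : ∀ j : ℕ, ((j : ℝ) + 1) *
        (∫ y, max (y - (a : ℝ)) 0 ∂r - ∫ y, max (y - ((a + 1 / ((j : ℚ) + 1) : ℚ) : ℝ)) 0 ∂r)
        = ∫ y, ((j : ℝ) + 1) * (max (y - (a : ℝ)) 0 - max (y - ((a : ℝ) + 1 / ((j : ℝ) + 1))) 0) ∂r := by
      intro j
      rw [integral_const_mul, integral_sub (hi _) (hi _)]
      push_cast
      rfl
    simp_rw [e]
    refine tendsto_integral_of_dominated_convergence (fun _ => (1 : ℝ)) ?_ (integrable_const _) ?_ ?_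
    · intro j
      exact (((hi _).sub (hi _)).const_mul _).aestronglyMeasurable
    · intro j
      refine Filter.Eventually.of_forall fun y => ?_
      have hj : (0 : ℝ) < (j : ℝ) + 1 := by positivity
      have hj2 : ((j : ℝ) + 1) * (1 / ((j : ℝ) + 1)) = 1 := by field_simp
      have hj3 : 0 < 1 / ((j : ℝ) + 1) := by positivity
      set d := 1 / ((j : ℝ) + 1)
      have h1 : 0 ≤ max (y - (a : ℝ)) 0 - max (y - ((a : ℝ) + d)) 0 := by
        rcases max_cases (y - (a : ℝ)) 0 with h | h <;>
          rcases max_cases (y - ((a : ℝ) + d)) 0 with h' | h' <;> linarith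
      have h2 : max (y - (a : ℝ)) 0 - max (y - ((a : ℝ) + d)) 0 ≤ d := by
        rcases max_cases (y - (a : ℝ)) 0 with h | h <;>
          rcases max_cases (y - ((a : ℝ) + d)) 0 with h' | h' <;> linarith
      rw [Real.norm_eq_abs, abs_of_nonneg (mul_nonneg hj.le h1)]
      calc _ ≤ ((j : ℝ) + 1) * d := mul_le_mul_of_nonneg_left h2 hj.le
        _ = 1 := hj2
    · refine Filter.Eventually.of_forall fun y => ?_
      refine tendsto_const_nhds.congr' ?_
      by_cases hy : (a : ℝ) < y
      · have := (tendsto_one_div_add_atTop_nhds_zero_nat (𝕜 := ℝ)).eventually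
          (gt_mem_nhds (sub_pos.2 hy))
        filter_upwards [this] with j hj
        have hj2 : ((j : ℝ) + 1) * (1 / ((j : ℝ) + 1)) = 1 := by field_simp
        rw [Set.indicator_of_mem (by exact hy), max_eq_left (by linarith),
          max_eq_left (by linarith)]
        simp only [Pi.one_apply]
        linear_combination -hj2
      · refine Filter.Eventually.of_forall fun j => ?_
        have hj3 : 0 < 1 / ((j : ℝ) + 1) := by positivity
        have e1 : max (y - (a : ℝ)) 0 = 0 := max_eq_right (by linarith)
        have e2 : max (y - ((a : ℝ) + 1 / ((j : ℝ) + 1))) 0 = 0 := max_eq_right (by linarith)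
        beta_reduce
        rw [Set.indicator_of_notMem (by exact hy), e1, e2]
        simp
  have hI : ∀ a : ℚ, m (Set.Ioi (a : ℝ)) = n (Set.Ioi (a : ℝ)) := by
    intro a
    have h1 := key m hm a
    simp_rw [h] at h1
    have := tendsto_nhds_unique h1 (key n hn a)
    exact (measureReal_eq_measureReal_iff).1 this
  refine ext_of_generate_finite _ (BorelSpace.measurable_eq.trans Real.borel_eq_generateFrom_Ioi_rat) Real.isPiSystem_Ioi_rat ?_ (by simp)
  intro s hs
  simp only [Set.mem_iUnion, Set.mem_singleton_iff] at hs
  obtain ⟨a, rfl⟩ := hs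
  exact hI a

/-- A disintegration kernel has finite first moments almost surely. -/
theorem integrable_of_isDisint {T : ℕ} (Q : Measure (Fin T → ℝ)) [IsProbabilityMeasure Q]
    (s u : Fin T) (K : Kernel ℝ ℝ) (hK : IsDisint Q s u K)
    (hu : Integrable (fun x : ℝ => x) (marginal Q u)) :
    ∀ᵐ x ∂(marginal Q s), Integrable (fun y : ℝ => y) (K x) := by
  obtain ⟨_, hj⟩ := hK
  have : IsProbabilityMeasure (marginal Q s) :=
    Measure.isProbabilityMeasure_map (measurable_pi_apply s).aemeasurable
  have h1 : Integrable (fun p : ℝ × ℝ => p.2) (joint Q s u) := by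
    unfold joint
    unfold marginal at hu
    have m1 : Measurable (fun x : Fin T → ℝ => x s) := measurable_pi_apply s
    have m2 : Measurable (fun x : Fin T → ℝ => x u) := measurable_pi_apply u
    rw [integrable_map_measure (by fun_prop) m2.aemeasurable] at hu
    rw [integrable_map_measure (by fun_prop) (m1.prodMk m2).aemeasurable]
    exact hu
  rw [hj] at h1
  exact ((Measure.integrable_compProd_iff h1.aestronglyMeasurable).1 h1).1

/-- `Q` with marginals `μ_t` is homogeneous iff the pricing rules
`p_{s,τ,k}(x) = ∫ (y-k)^+ K_{s,s+τ}(x,dy)` satisfy `p_{s,τ,k} = p_{t,τ,k}`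
`μ_s ∧ μ_t`-a.s. for every `(s,t,τ) ∈ Δ` and every `k ∈ ℝ`. -/
theorem homogeneous_iff_pricing_rules
    {T : ℕ} (hT : 2 ≤ T) (μ : Fin T → Measure ℝ)
    (hprob : ∀ t, IsProbabilityMeasure (μ t))
    (hmom : ∀ t, Integrable (fun x : ℝ => x) (μ t))
    (Q : Measure (Fin T → ℝ)) [IsProbabilityMeasure Q]
    (hmarg : ∀ t, marginal Q t = μ t) :
    IsHom Q ↔
      ∀ (s t : Fin T) (τ : ℕ) (hs : s.val + τ < T) (ht : t.val + τ < T),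
        s < t → 1 ≤ τ →
        ∀ Ks Kt : Kernel ℝ ℝ,
          IsDisint Q s ⟨s.val + τ, hs⟩ Ks → IsDisint Q t ⟨t.val + τ, ht⟩ Kt →
          ∀ k : ℝ, ∀ᵐ x ∂(absPart (μ s) (μ t)),
            ∫ y, max (y - k) 0 ∂(Ks x) = ∫ y, max (y - k) 0 ∂(Kt x) := by
  constructor
  · intro H s t τ hs ht hst hτ Ks Kt hKs hKt k
    have := H s t τ hs ht hst hτ Ks Kt hKs hKt
    rw [hmarg, hmarg] at this
    filter_upwards [this] with x hx
    rw [hx]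
  · intro H s t τ hs ht hst hτ Ks Kt hKs hKt
    have h0 := H s t τ hs ht hst hτ Ks Kt hKs hKt
    have hs1 := integrable_of_isDisint Q _ _ Ks hKs (by rw [hmarg]; exact hmom _)
    have ht1 := integrable_of_isDisint Q _ _ Kt hKt (by rw [hmarg]; exact hmom _)
    rw [hmarg] at hs1 ht1
    rw [hmarg, hmarg]
    have a1 : absPart (μ s) (μ t) ≪ μ s :=
      Measure.absolutelyContinuous_of_le (Measure.withDensity_rnDeriv_le _ _)
    have a2 : absPart (μ s) (μ t) ≪ μ t := withDensity_absolutelyContinuous _ _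
    have h1 : ∀ᵐ x ∂(absPart (μ s) (μ t)), ∀ q : ℚ,
        ∫ y, max (y - (q : ℝ)) 0 ∂(Ks x) = ∫ y, max (y - (q : ℝ)) 0 ∂(Kt x) :=
      ae_all_iff.2 fun q => h0 q
    have := hKs.1
    have := hKt.1
    filter_upwards [h1, a1.ae_le hs1, a2.ae_le ht1] with x hx hxs hxt
    exact measure_eq_of_calls _ _ hxs hxt hx
end
end

section
/- The set Π_hom(μ_1,…,μ_T) of homogeneous couplings is convex: if Q^a, Q^b ∈ Π_hom(μ_1,…,μ_T) and λ ∈ (0,1), then λQ^a + (1−λ)Q^b ∈ Π_hom(μ_1,…,μ_T). -/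
open MeasureTheory ProbabilityTheory

noncomputable section

open scoped ENNReal

/-- The pointwise mixture `a K + b L` of two kernels. -/
def mixKer (a b : ℝ≥0∞) (K L : Kernel ℝ ℝ) : Kernel ℝ ℝ where
  toFun x := a • K x + b • L x
  measurable' := by
    refine Measure.measurable_of_measurable_coe _ fun s hs => ?_
    simp only [Measure.add_apply, Measure.smul_apply, smul_eq_mul]
    exact ((K.measurable_coe hs).const_mul a).add ((L.measurable_coe hs).const_mul b)

lemma mixKer_apply (a b : ℝ≥0∞) (K L : Kernel ℝ ℝ) (x : ℝ) :
    mixKer a b K L x = a • K x + b • L x := rfl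

lemma mixKer_markov (a b : ℝ≥0∞) (hab : a + b = 1) (K L : Kernel ℝ ℝ)
    [IsMarkovKernel K] [IsMarkovKernel L] : IsMarkovKernel (mixKer a b K L) :=
  ⟨fun x => ⟨by simp [mixKer_apply, hab]⟩⟩

lemma exists_disint {T : ℕ} (Q : Measure (Fin T → ℝ)) [IsProbabilityMeasure Q] (s u : Fin T) :
    ∃ K, IsDisint Q s u K := by
  have : IsProbabilityMeasure (joint Q s u) :=
    Measure.isProbabilityMeasure_map (by fun_prop)
  refine ⟨(joint Q s u).condKernel, inferInstance, ?_⟩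
  have h : marginal Q s = (joint Q s u).fst := by
    rw [joint, Measure.fst_map_prodMk (by fun_prop), marginal]
  rw [h]
  exact ((joint Q s u).disintegrate _).symm

lemma marginal_mix {T : ℕ} (a b : ℝ≥0∞) (Qa Qb : Measure (Fin T → ℝ)) (t : Fin T) :
    marginal (a • Qa + b • Qb) t = a • marginal Qa t + b • marginal Qb t := by
  simp only [marginal]
  rw [Measure.map_add _ _ (by fun_prop), Measure.map_smul, Measure.map_smul]

lemma joint_mix {T : ℕ} (a b : ℝ≥0∞) (Qa Qb : Measure (Fin T → ℝ)) (s u : Fin T) :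
    joint (a • Qa + b • Qb) s u = a • joint Qa s u + b • joint Qb s u := by
  simp only [joint]
  rw [Measure.map_add _ _ (by fun_prop), Measure.map_smul, Measure.map_smul]

lemma disint_mix {T : ℕ} (a b : ℝ≥0∞) (hab : a + b = 1) (Qa Qb : Measure (Fin T → ℝ))
    (ν : Measure ℝ) [IsProbabilityMeasure ν] (s u : Fin T)
    (ha : marginal Qa s = ν) (hb : marginal Qb s = ν)
    (Ka Kb K : Kernel ℝ ℝ) (hKa : IsDisint Qa s u Ka) (hKb : IsDisint Qb s u Kb)
    (hK : IsDisint (a • Qa + b • Qb) s u K) :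
    ∀ᵐ x ∂ν, K x = a • Ka x + b • Kb x := by
  obtain ⟨_, hKa⟩ := hKa
  obtain ⟨_, hKb⟩ := hKb
  obtain ⟨_, hK⟩ := hK
  have := mixKer_markov a b hab Ka Kb
  have key : ν.compProd K = ν.compProd (mixKer a b Ka Kb) := by
    rw [marginal_mix, ha, hb, ← add_smul, hab, one_smul, joint_mix, hKa, hKb, ha, hb] at hK
    rw [← hK]
    ext S hS
    have m1 : Measurable fun x => Ka x (Prod.mk x ⁻¹' S) :=
      Kernel.measurable_kernel_prodMk_left hS
    have m2 : Measurable fun x => Kb x (Prod.mk x ⁻¹' S) :=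
      Kernel.measurable_kernel_prodMk_left hS
    simp only [Measure.add_apply, Measure.smul_apply, smul_eq_mul, Measure.compProd_apply hS,
      mixKer_apply]
    rw [lintegral_add_left (m1.const_mul a), lintegral_const_mul _ m1, lintegral_const_mul _ m2]
  exact Kernel.ae_eq_of_compProd_eq key

/-- the set `Π_hom(μ_1,…,μ_T)` of homogeneous couplings is convex. -/
theorem pi_hom_convex
    {T : ℕ} (hT : 2 ≤ T) (μ : Fin T → Measure ℝ)
    (hprob : ∀ t, IsProbabilityMeasure (μ t))
    (hmom : ∀ t, Integrable (fun x : ℝ => x) (μ t))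
    (Qa Qb : Measure (Fin T → ℝ)) [IsProbabilityMeasure Qa] [IsProbabilityMeasure Qb]
    (hma : ∀ t, marginal Qa t = μ t) (hmb : ∀ t, marginal Qb t = μ t)
    (hha : IsHom Qa) (hhb : IsHom Qb)
    (l : ℝ) (hl0 : 0 < l) (hl1 : l < 1) :
    IsProbabilityMeasure (ENNReal.ofReal l • Qa + ENNReal.ofReal (1 - l) • Qb) ∧
    (∀ t, marginal (ENNReal.ofReal l • Qa + ENNReal.ofReal (1 - l) • Qb) t = μ t) ∧
    IsHom (ENNReal.ofReal l • Qa + ENNReal.ofReal (1 - l) • Qb) := by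
  have hab : ENNReal.ofReal l + ENNReal.ofReal (1 - l) = 1 := by
    rw [← ENNReal.ofReal_add hl0.le (by linarith)]; simp
  have hm : ∀ t, marginal (ENNReal.ofReal l • Qa + ENNReal.ofReal (1 - l) • Qb) t = μ t := by
    intro t
    rw [marginal_mix, hma, hmb, ← add_smul, hab, one_smul]
  refine ⟨⟨by simp [hab]⟩, hm, ?_⟩
  intro s t τ hs ht hst hτ Ks Kt hKs hKt
  obtain ⟨Kas, hKas⟩ := exists_disint Qa s ⟨s.val + τ, hs⟩
  obtain ⟨Kbs, hKbs⟩ := exists_disint Qb s ⟨s.val + τ, hs⟩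
  obtain ⟨Kat, hKat⟩ := exists_disint Qa t ⟨t.val + τ, ht⟩
  obtain ⟨Kbt, hKbt⟩ := exists_disint Qb t ⟨t.val + τ, ht⟩
  have ea := hha s t τ hs ht hst hτ Kas Kat hKas hKat
  have eb := hhb s t τ hs ht hst hτ Kbs Kbt hKbs hKbt
  rw [hma, hma] at ea
  rw [hmb, hmb] at eb
  rw [hm, hm]
  have := hprob s
  have := hprob t
  have es := disint_mix _ _ hab Qa Qb (μ s) s _ (hma s) (hmb s) Kas Kbs Ks hKas hKbs hKs
  have et := disint_mix _ _ hab Qa Qb (μ t) t _ (hma t) (hmb t) Kat Kbt Kt hKat hKbt hKt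
  have acs : absPart (μ s) (μ t) ≪ μ s :=
    Measure.absolutelyContinuous_of_le (Measure.withDensity_rnDeriv_le _ _)
  have act : absPart (μ s) (μ t) ≪ μ t := withDensity_absolutelyContinuous _ _
  filter_upwards [ea, eb, acs.ae_le es, act.ae_le et] with x h1 h2 h3 h4
  rw [h3, h4, h1, h2]
end
end

section
/- The set P_hom(ℝ³) of homogeneous probability measures on ℝ³ is not convex. Specifically, the measures Q^a = 0.75 δ_{(0,1,0)} + 0.25 δ_{(1,0,1)} and Q^b = 0.75 δ_{(0,0,0)} + 0.25 δ_{(1,1,1)} are both homogeneous, but Q = 0.5 Q^a + 0.5 Q^b is not homogeneous. -/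
open MeasureTheory ProbabilityTheory
open scoped ENNReal

noncomputable section

theorem aux_key {T : ℕ} {Q : Measure (Fin T → ℝ)} [IsFiniteMeasure Q] {s u : Fin T} {K : Kernel ℝ ℝ}
    (h : IsDisint Q s u K) (x : ℝ) {B : Set ℝ} (hB : MeasurableSet B) :
    K x B * Q {y | y s = x} = Q {y | y s = x ∧ y u ∈ B} := by
  obtain ⟨hK, h⟩ := h
  have hf : IsFiniteMeasure (marginal Q s) := by unfold marginal; infer_instance
  have h1 := congrArg (fun m => m ({x} ×ˢ B)) h
  rw [Measure.compProd_apply_prod (measurableSet_singleton x) hB, joint,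
    Measure.map_apply (by fun_prop) ((measurableSet_singleton x).prod hB),
    Measure.restrict_singleton, lintegral_smul_measure, lintegral_dirac, marginal,
    Measure.map_apply (by fun_prop) (measurableSet_singleton x)] at h1
  rw [smul_eq_mul, mul_comm] at h1
  exact h1.symm

theorem aux_disint {T : ℕ} (Q : Measure (Fin T → ℝ)) [IsFiniteMeasure Q] (s u : Fin T) :
    ∃ K, IsDisint Q s u K := by
  have : IsFiniteMeasure (joint Q s u) := by unfold joint; infer_instance
  refine ⟨(joint Q s u).condKernel, inferInstance, ?_⟩
  have h : marginal Q s = (joint Q s u).fst := by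
    rw [Measure.fst, joint, Measure.map_map measurable_fst (by fun_prop)]
    rfl
  rw [h]
  exact ((joint Q s u).disintegrate _).symm

theorem aux_set {T : ℕ} (s u : Fin T) (x : ℝ) {B : Set ℝ} (hB : MeasurableSet B) :
    MeasurableSet {y : Fin T → ℝ | y s = x ∧ y u ∈ B} := by
  have h1 : Measurable fun y : Fin T → ℝ => y s := by fun_prop
  have h2 : Measurable fun y : Fin T → ℝ => y u := by fun_prop
  exact (h1 (measurableSet_singleton x)).inter (h2 hB)

theorem aux_set1 {T : ℕ} (s : Fin T) (x : ℝ) :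
    MeasurableSet {y : Fin T → ℝ | y s = x} := by
  have h1 : Measurable fun y : Fin T → ℝ => y s := by fun_prop
  exact h1 (measurableSet_singleton x)

theorem aux_fin (a b : ℝ≥0∞) (ha : a ≠ ⊤) (hb : b ≠ ⊤) (v w : Fin 3 → ℝ) :
    IsFiniteMeasure (a • Measure.dirac v + b • Measure.dirac w) := by
  constructor
  simp [ha.lt_top, hb.lt_top]

/-- Measures on two atoms with distinct first and second coordinates and a common successor map. -/
theorem aux_hom (v w : Fin 3 → ℝ) (f : ℝ → ℝ)
    (hv0 : v 1 = f (v 0)) (hv1 : v 2 = f (v 1)) (hw0 : w 1 = f (w 0)) (hw1 : w 2 = f (w 1))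
    (h0 : v 0 ≠ w 0) (h1 : v 1 ≠ w 1) (hc : v 1 = v 0 ∨ v 1 = w 0) (hd : w 1 = v 0 ∨ w 1 = w 0) :
    IsHom ((3 / 4 : ℝ≥0∞) • Measure.dirac v + (1 / 4 : ℝ≥0∞) • Measure.dirac w) := by
  have hf := aux_fin (3/4) (1/4) (by finiteness) (by finiteness) v w
  have e3 : (3/4 : ℝ≥0∞) ≠ 0 := by simp
  have e3' : (3/4 : ℝ≥0∞) ≠ ⊤ := by finiteness
  have e1 : (1/4 : ℝ≥0∞) ≠ 0 := by simp
  have e1' : (1/4 : ℝ≥0∞) ≠ ⊤ := by finiteness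
  generalize (3/4 : ℝ≥0∞) = a at *
  generalize (1/4 : ℝ≥0∞) = b at *
  set Q := a • Measure.dirac v + b • Measure.dirac w with hQ
  have main : ∀ (s u : Fin 3) (K : Kernel ℝ ℝ), IsDisint Q s u K → v u = f (v s) → w u = f (w s) →
      v s ≠ w s → ∀ x, (x = v s ∨ x = w s) → K x = Measure.dirac (f x) := by
    intro s u K hK hv hw hne x hx
    ext B hB
    have k := aux_key hK x hB
    rw [hQ] at k
    simp only [Measure.add_apply, Measure.smul_apply, smul_eq_mul,
      Measure.dirac_apply' _ (aux_set s u x hB), Measure.dirac_apply' _ (aux_set1 s x)] at k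
    rw [Measure.dirac_apply' _ hB]
    rcases hx with rfl | rfl
    · simp only [Set.indicator, Set.mem_ofPred_eq, hne.symm, hv, false_and, true_and, if_true,
        if_false, Pi.one_apply, mul_one, mul_zero, add_zero] at k ⊢
      rw [mul_comm] at k
      rw [(ENNReal.mul_right_inj e3 e3').1 k]
      refine @if_congr _ _ _ (_) (_) _ _ _ _ (by rw [hv]; exact and_iff_right rfl) rfl rfl
    · simp only [Set.indicator, Set.mem_ofPred_eq, hne, hw, false_and, true_and, if_true,
        if_false, Pi.one_apply, mul_one, mul_zero, zero_add] at k ⊢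
      rw [mul_comm] at k
      rw [(ENNReal.mul_right_inj e1 e1').1 k]
      refine @if_congr _ _ _ (_) (_) _ _ _ _ (by rw [hw]; exact and_iff_right rfl) rfl rfl
  intro s t τ hs ht hst hτ Ks Kt hKs hKt
  obtain rfl : s = 0 := by ext; simp; omega
  obtain rfl : t = 1 := by ext; simp; omega
  obtain rfl : τ = 1 := by simp at ht; omega
  have m1 := main 0 1 Ks hKs hv0 hw0 h0
  have m2 := main 1 2 Kt hKt hv1 hw1 h1
  refine (withDensity_absolutelyContinuous _ _).ae_le ?_
  have hms : MeasurableSet ({v 1, w 1} : Set ℝ) := by measurability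
  have : ∀ᵐ x ∂(marginal Q 1), x ∈ ({v 1, w 1} : Set ℝ) := by
    rw [marginal, ae_map_iff (p := fun x => x ∈ ({v 1, w 1} : Set ℝ)) (by exact (measurable_pi_apply (X := fun _ : Fin 3 => ℝ) 1).aemeasurable) hms, hQ, ae_add_measure_iff]
    have hm : MeasurableSet {y : Fin 3 → ℝ | y 1 ∈ ({v 1, w 1} : Set ℝ)} :=
      measurable_pi_apply 1 hms
    exact ⟨Measure.ae_smul_measure ((ae_dirac_iff hm).2 (by simp)) _,
      Measure.ae_smul_measure ((ae_dirac_iff hm).2 (by simp)) _⟩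
  filter_upwards [this] with x hx
  rcases hx with rfl | hx
  · rw [m1 _ hc, m2 _ (Or.inl rfl)]
  · rw [Set.mem_singleton_iff] at hx
    subst hx
    rw [m1 _ hd, m2 _ (Or.inr rfl)]

/-- `P_hom(ℝ³)` is not convex: `Q^a = 0.75 δ_{(0,1,0)} + 0.25 δ_{(1,0,1)}`
and `Q^b = 0.75 δ_{(0,0,0)} + 0.25 δ_{(1,1,1)}` are homogeneous, but their average
`Q = 0.5 Q^a + 0.5 Q^b` is not. -/
theorem p_hom_not_convex :
    IsHom ((3 / 4 : ℝ≥0∞) • Measure.dirac ![(0 : ℝ), 1, 0]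
            + (1 / 4 : ℝ≥0∞) • Measure.dirac ![(1 : ℝ), 0, 1]) ∧
    IsHom ((3 / 4 : ℝ≥0∞) • Measure.dirac ![(0 : ℝ), 0, 0]
            + (1 / 4 : ℝ≥0∞) • Measure.dirac ![(1 : ℝ), 1, 1]) ∧
    ¬ IsHom ((1 / 2 : ℝ≥0∞) •
              ((3 / 4 : ℝ≥0∞) • Measure.dirac ![(0 : ℝ), 1, 0]
                + (1 / 4 : ℝ≥0∞) • Measure.dirac ![(1 : ℝ), 0, 1])
            + (1 / 2 : ℝ≥0∞) •
              ((3 / 4 : ℝ≥0∞) • Measure.dirac ![(0 : ℝ), 0, 0]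
                + (1 / 4 : ℝ≥0∞) • Measure.dirac ![(1 : ℝ), 1, 1])) := by
  refine ⟨aux_hom _ _ (fun x => 1 - x) ?_ ?_ ?_ ?_ ?_ ?_ ?_ ?_,
    aux_hom _ _ id ?_ ?_ ?_ ?_ ?_ ?_ ?_ ?_, ?_⟩
  any_goals simp; done
  have hf1 := aux_fin (3/4) (1/4) (by finiteness) (by finiteness) ![(0 : ℝ), 1, 0] ![(1 : ℝ), 0, 1]
  have hf2 := aux_fin (3/4) (1/4) (by finiteness) (by finiteness) ![(0 : ℝ), 0, 0] ![(1 : ℝ), 1, 1]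
  set Q := ((1 / 2 : ℝ≥0∞) •
              ((3 / 4 : ℝ≥0∞) • Measure.dirac ![(0 : ℝ), 1, 0]
                + (1 / 4 : ℝ≥0∞) • Measure.dirac ![(1 : ℝ), 0, 1])
            + (1 / 2 : ℝ≥0∞) •
              ((3 / 4 : ℝ≥0∞) • Measure.dirac ![(0 : ℝ), 0, 0]
                + (1 / 4 : ℝ≥0∞) • Measure.dirac ![(1 : ℝ), 1, 1])) with hQ
  have hfin : IsFiniteMeasure Q := by
    have h1 := Measure.smul_finite (c := 1/2) (hc := by finiteness) (μ := ((3 / 4 : ℝ≥0∞) • Measure.dirac ![(0 : ℝ), 1, 0]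
                + (1 / 4 : ℝ≥0∞) • Measure.dirac ![(1 : ℝ), 0, 1]))
    have h2 := Measure.smul_finite (c := 1/2) (hc := by finiteness) (μ := ((3 / 4 : ℝ≥0∞) • Measure.dirac ![(0 : ℝ), 0, 0]
                + (1 / 4 : ℝ≥0∞) • Measure.dirac ![(1 : ℝ), 1, 1]))
    rw [hQ]; infer_instance
  intro H
  obtain ⟨K, hK⟩ := aux_disint Q 0 1
  obtain ⟨L, hL⟩ := aux_disint Q 1 2
  have hae := H 0 1 1 (by simp) (by simp) (by simp) le_rfl K L hK hL
  have f0 : IsFiniteMeasure (marginal Q 0) := by unfold marginal; infer_instance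
  have f1 : IsFiniteMeasure (marginal Q 1) := by unfold marginal; infer_instance
  have hac : marginal Q 0 ≪ marginal Q 1 := by
    refine Measure.AbsolutelyContinuous.mk fun s hs h => ?_
    rw [marginal, Measure.map_apply (by fun_prop) hs] at h ⊢
    have hm (i : Fin 3) : MeasurableSet ((fun x : Fin 3 → ℝ => x i) ⁻¹' s) :=
      measurable_pi_apply i hs
    rw [hQ] at h ⊢
    simp [Measure.dirac_apply' _ (hm _)] at h ⊢
    tauto
  rw [absPart, Measure.withDensity_rnDeriv_eq _ _ hac] at hae
  have hKL : K 0 = L 0 := by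
    by_contra hne
    have h0 : marginal Q 0 {0} = 0 :=
      measure_mono_null (by rintro x rfl; exact hne) (ae_iff.1 hae)
    rw [marginal, Measure.map_apply (by fun_prop) (measurableSet_singleton _)] at h0
    have hm : MeasurableSet ((fun x : Fin 3 → ℝ => x 0) ⁻¹' {0}) :=
      measurable_pi_apply 0 (measurableSet_singleton _)
    rw [hQ] at h0
    simp [Measure.dirac_apply' _ hm] at h0
  have k1 := aux_key hK 0 (measurableSet_singleton 1)
  have k2 := aux_key hL 0 (measurableSet_singleton 1)
  rw [← hKL] at k2
  generalize K 0 {1} = c at k1 k2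
  rw [hQ] at k1 k2
  simp only [Measure.add_apply, Measure.smul_apply, smul_eq_mul,
      Measure.dirac_apply' _ (aux_set _ _ _ (measurableSet_singleton (1:ℝ))),
      Measure.dirac_apply' _ (aux_set1 _ _)] at k1 k2
  simp [Set.indicator] at k1 k2
  have k1' := congrArg ENNReal.toReal k1
  have k2' := congrArg ENNReal.toReal k2
  rw [ENNReal.toReal_mul, ENNReal.toReal_add (by finiteness) (by finiteness)] at k1' k2'
  simp only [ENNReal.toReal_mul, ENNReal.toReal_div, ENNReal.toReal_inv, ENNReal.toReal_ofNat] at k1' k2'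
  linarith
end
end

section
/- Every probability measure Q on ℝ^T under which the coordinate process is a time-homogeneous Markov chain is homogeneous, i.e., P_HM(ℝ^T) ⊆ P_hom(ℝ^T). -/
open MeasureTheory ProbabilityTheory
open scoped ENNReal

noncomputable section

/-- The coordinate process is a time-homogeneous Markov chain with transition kernel `K`
under `Q`: for each `n` with `n+1 < T`, the conditional law of coordinate `n+1` given the
first `n+1` coordinates is `K` applied to coordinate `n`, expressed via disintegration. -/
def IsHomMarkovChain {T : ℕ} (Q : Measure (Fin T → ℝ)) (K : Kernel ℝ ℝ) : Prop :=
  IsMarkovKernel K ∧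
  ∀ (n : ℕ) (hn : n + 1 < T),
    Q.map (fun x => ((fun i : Fin (n + 1) => x (Fin.castLE (by omega) i)), x ⟨n + 1, hn⟩))
      = (Q.map (fun x => fun i : Fin (n + 1) => x (Fin.castLE (by omega) i))).compProd
          (K.comap (fun v : Fin (n + 1) → ℝ => v (Fin.last n)) (measurable_pi_apply _))

/-- Iterates of a kernel. -/
def kpow (K : Kernel ℝ ℝ) : ℕ → Kernel ℝ ℝ
  | 0 => Kernel.id
  | n + 1 => K ∘ₖ kpow K n

lemma kpow_markov (K : Kernel ℝ ℝ) [IsMarkovKernel K] (n : ℕ) : IsMarkovKernel (kpow K n) := by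
  induction n with
  | zero => unfold kpow; infer_instance
  | succ n ih => unfold kpow; infer_instance

lemma step {T : ℕ} (Q : Measure (Fin T → ℝ)) [IsProbabilityMeasure Q] (K : Kernel ℝ ℝ)
    (h : IsHomMarkovChain Q K) (s n : ℕ) (hsn : s ≤ n) (hn : n + 1 < T) (A B : Set ℝ)
    (hA : MeasurableSet A) (hB : MeasurableSet B) :
    Q {x | x ⟨s, by omega⟩ ∈ A ∧ x ⟨n + 1, hn⟩ ∈ B} =
      ∫⁻ x in {x | x ⟨s, by omega⟩ ∈ A}, K (x ⟨n, by omega⟩) B ∂Q := by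
  obtain ⟨hK, h⟩ := h
  have h1 := h n hn
  have hm : Measurable (fun x : Fin T → ℝ => fun i : Fin (n + 1) =>
      x (Fin.castLE (by omega) i)) := by fun_prop
  have hA' : MeasurableSet {v : Fin (n + 1) → ℝ | v ⟨s, by omega⟩ ∈ A} :=
    (measurable_pi_apply _) hA
  have h2 := congrArg (fun μ => μ ({v : Fin (n + 1) → ℝ | v ⟨s, by omega⟩ ∈ A} ×ˢ B)) h1
  have : IsProbabilityMeasure (Q.map (fun x : Fin T → ℝ => fun i : Fin (n + 1) =>
      x (Fin.castLE (by omega) i))) := Measure.isProbabilityMeasure_map hm.aemeasurable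
  rw [Measure.map_apply (by fun_prop) (hA'.prod hB), Measure.compProd_apply_prod hA' hB,
    setLIntegral_map hA' (Kernel.measurable_coe _ hB) hm] at h2
  exact h2

lemma joint_eq {T : ℕ} (Q : Measure (Fin T → ℝ)) [IsProbabilityMeasure Q] (K : Kernel ℝ ℝ)
    (h : IsHomMarkovChain Q K) (s : Fin T) (τ : ℕ) (hs : s.val + τ < T) :
    joint Q s ⟨s.val + τ, hs⟩ = (marginal Q s).compProd (kpow K τ) := by
  have hK := h.1
  have hp : ∀ t, IsProbabilityMeasure (marginal Q t) := fun t =>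
    Measure.isProbabilityMeasure_map (measurable_pi_apply t).aemeasurable
  induction τ with
  | zero =>
    simp only [kpow, joint, marginal]
    rw [Measure.compProd_id, Measure.map_map (by fun_prop) (by fun_prop)]
    rfl
  | succ n ih =>
    have hM := kpow_markov K n
    have hM' := kpow_markov K (n + 1)
    have ih := ih (by omega)
    have : IsProbabilityMeasure (joint Q s ⟨s.val + (n + 1), hs⟩) :=
      Measure.isProbabilityMeasure_map (by fun_prop)
    apply Measure.ext_prod
    intro A B hA hB
    have e := step Q K h s (s + n) (by omega) (by omega) A B hA hB
    have hf : Measurable (fun p : ℝ × ℝ => K p.2 B) := 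
      (Kernel.measurable_coe K hB).comp measurable_snd
    have e1 : joint Q s ⟨s.val + (n + 1), hs⟩ (A ×ˢ B) =
        Q {x | x s ∈ A ∧ x ⟨s + n + 1, by omega⟩ ∈ B} := by
      unfold joint
      rw [Measure.map_apply (by fun_prop) (hA.prod hB)]
      rfl
    have e2 : ∫⁻ x in {x | x s ∈ A}, K (x ⟨s + n, by omega⟩) B ∂Q =
        ∫⁻ p in A ×ˢ Set.univ, K p.2 B ∂(joint Q s ⟨s + n, by omega⟩) := by
      unfold joint
      rw [setLIntegral_map (hA.prod MeasurableSet.univ) hf (by fun_prop)]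
      congr 2
      ext x
      simp
    rw [e1, e.trans e2, ih, Measure.setLIntegral_compProd hf hA MeasurableSet.univ,
      Measure.compProd_apply_prod hA hB]
    simp only [kpow, Measure.restrict_univ]
    simp_rw [Kernel.comp_apply' _ _ _ hB]

/-- every law of a time-homogeneous Markov chain is homogeneous,
i.e. `P_HM(ℝ^T) ⊆ P_hom(ℝ^T)`. -/
theorem homMarkov_subset_hom
    {T : ℕ} (hT : 2 ≤ T) (Q : Measure (Fin T → ℝ)) [IsProbabilityMeasure Q]
    (h : ∃ K : Kernel ℝ ℝ, IsHomMarkovChain Q K) :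
    IsHom Q := by
  obtain ⟨K, h⟩ := h
  intro s t τ hs ht _ _ Ks Kt hKs hKt
  have hK := h.1
  have hM := kpow_markov K τ
  have hp : ∀ t, IsProbabilityMeasure (marginal Q t) := fun t =>
    Measure.isProbabilityMeasure_map (measurable_pi_apply t).aemeasurable
  have := hKs.1
  have := hKt.1
  have a1 : Ks =ᵐ[marginal Q s] kpow K τ :=
    Kernel.ae_eq_of_compProd_eq (hKs.2.symm.trans (joint_eq Q K h s τ hs))
  have a2 : Kt =ᵐ[marginal Q t] kpow K τ :=
    Kernel.ae_eq_of_compProd_eq (hKt.2.symm.trans (joint_eq Q K h t τ ht))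
  have c1 : absPart (marginal Q s) (marginal Q t) ≪ marginal Q s :=
    Measure.absolutelyContinuous_of_le (Measure.withDensity_rnDeriv_le _ _)
  have c2 : absPart (marginal Q s) (marginal Q t) ≪ marginal Q t :=
    withDensity_absolutelyContinuous _ _
  filter_upwards [c1.ae_le a1, c2.ae_le a2] with x h1 h2
  rw [h1, h2]
end
end

section
/- The probability measure Q := 0.25 δ_{(0,0,1)} + 0.25 δ_{(1,1,0)} + 0.25 δ_{(0,1,1)} + 0.25 δ_{(1,0,0)} on ℝ³ is homogeneous, but it is not a finite convex combination of laws of time-homogeneous Markov chains; that is, Q ∈ P_hom(ℝ³) but Q ∉ conv(P_HM(ℝ³)). In particular the inclusion conv(P_HM(ℝ^T)) ⊆ P_hom(ℝ^T) is strict for T = 3. -/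
open MeasureTheory ProbabilityTheory
open scoped ENNReal

noncomputable section

lemma step_aux {n : ℕ} (P : Measure (Fin 3 → ℝ)) [IsProbabilityMeasure P] (K : Kernel ℝ ℝ)
    [IsMarkovKernel K] (f : (Fin 3 → ℝ) → (Fin (n + 1) → ℝ)) (hf : Measurable f) (u : Fin 3)
    (h : P.map (fun x => (f x, x u)) = (P.map f).compProd
      (K.comap (fun v : Fin (n + 1) → ℝ => v (Fin.last n)) (measurable_pi_apply _))) :
    P {x | f x = 0 ∧ x u = 0} = K 0 {0} * P {x | f x = 0} := by
  have : IsProbabilityMeasure (P.map f) := Measure.isProbabilityMeasure_map hf.aemeasurable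
  have h1 := congrArg (fun m => m ({0} ×ˢ {0})) h
  beta_reduce at h1
  rw [Measure.map_apply (by fun_prop) (by measurability),
    Measure.compProd_apply_prod (by measurability) (by measurability)] at h1
  simp only [Measure.restrict_singleton, lintegral_smul_measure, lintegral_dirac,
    Kernel.comap_apply, smul_eq_mul] at h1
  rw [Measure.map_apply hf (by measurability)] at h1
  rw [mul_comm]
  simpa [Set.preimage, Set.mem_prod] using h1

lemma markov_aux (P : Measure (Fin 3 → ℝ)) [IsProbabilityMeasure P] (K : Kernel ℝ ℝ)
    (h : IsHomMarkovChain P K) (h0 : P {x | x 0 = 0 ∧ x 1 = 0 ∧ x 2 = 0} = 0) :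
    P {x | x 0 = 0 ∧ x 1 = 0} = 0 := by
  obtain ⟨hK, h⟩ := h
  have a := step_aux P K _ (by fun_prop) _ (h 0 (by omega))
  have b := step_aux P K _ (by fun_prop) _ (h 1 (by omega))
  have e1 : {x : Fin 3 → ℝ | (fun i : Fin (0 + 1) => x (Fin.castLE (by omega) i)) = 0 ∧
      x ⟨0 + 1, by omega⟩ = 0} = {x | x 0 = 0 ∧ x 1 = 0} := by
    ext x
    simp only [Set.mem_ofPred_eq, funext_iff]
    exact and_congr ⟨fun h => h 0, fun h i => by fin_cases i; exact h⟩ Iff.rfl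
  have e2 : {x : Fin 3 → ℝ | (fun i : Fin (1 + 1) => x (Fin.castLE (by omega) i)) = 0} =
      {x | x 0 = 0 ∧ x 1 = 0} := by
    ext x
    simp only [Set.mem_ofPred_eq, funext_iff]
    exact ⟨fun h => ⟨h 0, h 1⟩, fun h i => by fin_cases i; exacts [h.1, h.2]⟩
  have e3 : {x : Fin 3 → ℝ | (fun i : Fin (1 + 1) => x (Fin.castLE (by omega) i)) = 0 ∧
      x ⟨1 + 1, by omega⟩ = 0} = {x | x 0 = 0 ∧ x 1 = 0 ∧ x 2 = 0} := by
    ext x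
    simp only [Set.mem_ofPred_eq, funext_iff]
    exact ⟨fun h => ⟨h.1 0, h.1 1, h.2⟩,
      fun h => ⟨fun i => by fin_cases i; exacts [h.1, h.2.1], h.2.2⟩⟩
  rw [e1] at a
  rw [e3, e2, h0] at b
  rcases mul_eq_zero.1 b.symm with hk | hk
  · rw [a, hk, zero_mul]
  · exact hk

/-- the measure `Q = 0.25 δ_{(0,0,1)} + 0.25 δ_{(1,1,0)} + 0.25 δ_{(0,1,1)}
+ 0.25 δ_{(1,0,0)}` on `ℝ³` is homogeneous but is not a finite convex combination of laws
of time-homogeneous Markov chains: `Q ∈ P_hom(ℝ³)` but `Q ∉ conv(P_HM(ℝ³))`, so the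
inclusion `conv(P_HM) ⊆ P_hom` is strict for `T = 3`. -/
theorem hom_strictly_larger_than_conv_homMarkov :
    IsHom ((1 / 4 : ℝ≥0∞) • Measure.dirac ![(0 : ℝ), 0, 1]
          + (1 / 4 : ℝ≥0∞) • Measure.dirac ![(1 : ℝ), 1, 0]
          + (1 / 4 : ℝ≥0∞) • Measure.dirac ![(0 : ℝ), 1, 1]
          + (1 / 4 : ℝ≥0∞) • Measure.dirac ![(1 : ℝ), 0, 0]) ∧
    ¬ ∃ (n : ℕ) (w : Fin n → ℝ≥0∞) (P : Fin n → Measure (Fin 3 → ℝ)),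
        (∑ i, w i) = 1 ∧
        (∀ i, IsProbabilityMeasure (P i)) ∧
        (∀ i, ∃ K : Kernel ℝ ℝ, IsHomMarkovChain (P i) K) ∧
        ((1 / 4 : ℝ≥0∞) • Measure.dirac ![(0 : ℝ), 0, 1]
          + (1 / 4 : ℝ≥0∞) • Measure.dirac ![(1 : ℝ), 1, 0]
          + (1 / 4 : ℝ≥0∞) • Measure.dirac ![(0 : ℝ), 1, 1]
          + (1 / 4 : ℝ≥0∞) • Measure.dirac ![(1 : ℝ), 0, 0]) = ∑ i, w i • P i := by
  constructor
  · intro s t τ hs ht hst hτ Ks Kt hKs hKt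
    obtain ⟨s, hs'⟩ := s
    obtain ⟨t, ht'⟩ := t
    simp only [Fin.mk_lt_mk] at hs ht hst
    obtain rfl : s = 0 := by omega
    obtain rfl : t = 1 := by omega
    obtain rfl : τ = 1 := by omega
    obtain ⟨_, h1⟩ := hKs
    obtain ⟨_, h2⟩ := hKt
    refine (withDensity_absolutelyContinuous _ _).ae_le ?_
    have hm : ∀ i : Fin 3, Measurable (fun x : Fin 3 → ℝ => x i) := fun i => by fun_prop
    have hm2 : ∀ i j : Fin 3, Measurable (fun x : Fin 3 → ℝ => (x i, x j)) :=
      fun i j => by fun_prop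
    have hM : ∀ Q : Measure (Fin 3 → ℝ), IsFiniteMeasure Q → IsFiniteMeasure (marginal Q ⟨1, ht'⟩) := by
      intro Q hQ
      unfold marginal
      infer_instance
    have := hM ((1 / 4 : ℝ≥0∞) • Measure.dirac ![(0 : ℝ), 0, 1]
          + (1 / 4 : ℝ≥0∞) • Measure.dirac ![(1 : ℝ), 1, 0]
          + (1 / 4 : ℝ≥0∞) • Measure.dirac ![(0 : ℝ), 1, 1]
          + (1 / 4 : ℝ≥0∞) • Measure.dirac ![(1 : ℝ), 0, 0]) ⟨by simp⟩
    apply Kernel.ae_eq_of_compProd_eq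
    refine Eq.trans ?_ h2
    refine Eq.trans ?_ (Eq.trans h1.symm ?_)
    · congr 1
      simp only [marginal, Measure.map_add _ _ (hm _), Measure.map_smul,
        Measure.map_dirac' (hm _)]
      simp
      abel
    · simp only [joint, Measure.map_add _ _ (hm2 _ _), Measure.map_smul,
        Measure.map_dirac' (hm2 _ _)]
      simp
      abel
  · rintro ⟨n, w, P, hw, hP, hM, hQ⟩
    have m3 : MeasurableSet {x : Fin 3 → ℝ | x 0 = 0 ∧ x 1 = 0 ∧ x 2 = 0} := by
      measurability
    have m2 : MeasurableSet {x : Fin 3 → ℝ | x 0 = 0 ∧ x 1 = 0} := by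
      measurability
    have q3 := congrArg (fun m => m {x : Fin 3 → ℝ | x 0 = 0 ∧ x 1 = 0 ∧ x 2 = 0}) hQ
    have q2 := congrArg (fun m => m {x : Fin 3 → ℝ | x 0 = 0 ∧ x 1 = 0}) hQ
    simp [Measure.dirac_apply' _ m3] at q3
    have q3 := Finset.sum_eq_zero_iff.1 q3.symm
    have : ∑ i, w i * P i {x : Fin 3 → ℝ | x 0 = 0 ∧ x 1 = 0} = 0 := by
      refine Finset.sum_eq_zero fun i _ => ?_
      obtain ⟨K, hK⟩ := hM i
      have := hP i
      rcases mul_eq_zero.1 (q3 i (Finset.mem_univ i)) with h | h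
      · rw [h, zero_mul]
      · rw [markov_aux (P i) K hK h, mul_zero]
    simp [Measure.dirac_apply' _ m2, this] at q2
end
end

section
/- Let μ and ν be finite Borel measures on ℝ, and let μ = μ^{ν,abs} + μ^{ν,singular} and ν = ν^{μ,abs} + ν^{μ,singular} be their Lebesgue decompositions, where μ^{ν,abs} ≪ ν, μ^{ν,singular} ⊥ ν, ν^{μ,abs} ≪ μ, ν^{μ,singular} ⊥ μ. Then μ^{ν,abs} and ν^{μ,abs} are mutually absolutely continuous, i.e., they have exactly the same null sets. -/
open MeasureTheory

noncomputable section

/-- for finite Borel measures `μ, ν` on `ℝ` with Lebesgue decompositions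
`μ = μ^{ν,abs} + μ^{ν,sing}` and `ν = ν^{μ,abs} + ν^{μ,sing}`, the absolutely continuous
parts `μ^{ν,abs}` and `ν^{μ,abs}` are mutually absolutely continuous, i.e. they have the
same null sets. -/
theorem abs_parts_mutually_ac
    (μ ν μa μs νa νs : Measure ℝ)
    [IsFiniteMeasure μ] [IsFiniteMeasure ν]
    (hμ : μ = μa + μs) (hμa : μa ≪ ν) (hμs : Measure.MutuallySingular μs ν)
    (hν : ν = νa + νs) (hνa : νa ≪ μ) (hνs : Measure.MutuallySingular νs μ) :
    μa ≪ νa ∧ νa ≪ μa := by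
  have h1 : μa ≤ μ := hμ ▸ Measure.le_add_right le_rfl
  have h2 : νa ≤ ν := hν ▸ Measure.le_add_right le_rfl
  constructor
  · exact Measure.absolutelyContinuous_of_add_of_mutuallySingular (hν ▸ hμa)
      (hνs.symm.mono h1 le_rfl)
  · exact Measure.absolutelyContinuous_of_add_of_mutuallySingular (hμ ▸ hνa)
      (hμs.symm.mono h2 le_rfl)
end
end
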